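/- arXiv:2605.00949 — 2 statements merged into one kernel-verified Lean document; each statement's English description precedes it below -/
import Mathlib

section
/- Let F(x) = (x^k + b)^n + c·∑_{i=1}^{n} (a(x^k + b))^{n-i} ∈ ℤ[x] be irreducible of degree nk over ℚ, let θ be a root of F, and K = ℚ(θ). Let p be a prime divisor of the discriminant 𝔇_F with p ∤ c, p ∣ k, p ∣ a and p ∣ n; write k = p^j s′ with p ∤ s′ and n = p^i s with p ∤ s, and set a₁ = a/p and c₂ = (c + (−c)^{p^{i+j}})/p. Then p does not divide the index [ℤ_K : ℤ[θ]] if and only if p ∤ (c^{n+1} a₁^n + (−c₂)^n). -/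
open Polynomial

/-- `D` is the discriminant of the integer polynomial `f`: writing the roots of `f`
in `ℂ` as `θ_1, …, θ_d` (so that `f` splits as `∏ (X - θ_i)` over `ℂ`),
`D = ∏_{i < j} (θ_i - θ_j)^2`. -/
def IsDiscriminant (f : Polynomial ℤ) (D : ℤ) : Prop :=
  ∃ θ : Fin f.natDegree → ℂ,
    f.map (algebraMap ℤ ℂ) = ∏ i, (X - C (θ i)) ∧
      (D : ℂ) = ∏ i, ∏ j ∈ Finset.Ioi i, (θ i - θ j) ^ 2

theorem C_dvd_of_map_zmod_eq_zero {p : ℕ} {f : ℤ[X]}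
    (hf : f.map (Int.castRingHom (ZMod p)) = 0) : C (p : ℤ) ∣ f := by
  rw [C_dvd_iff_dvd_coeff]
  intro m
  rw [← ZMod.intCast_zmod_eq_zero_iff_dvd]
  simpa using congrArg (fun q => coeff q m) hf

theorem pow_sub_pow_mem_sq {R : Type*} [CommRing R] {Q : Ideal R} {x y : R} {n : ℕ}
    (hxy : x - y ∈ Q) (hn : (n : R) ∈ Q) : x ^ n - y ^ n ∈ Q ^ 2 := by
  obtain ⟨t, ht⟩ := powAddExpansion y (x - y) n
  rw [add_sub_cancel] at ht
  have : x ^ n - y ^ n = y ^ (n - 1) * (n * (x - y)) + t * (x - y) ^ 2 := by rw [ht]; ring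
  rw [this, sq Q, sq (x - y)]
  exact add_mem (Ideal.mul_mem_left _ _ (Ideal.mul_mem_mul hn hxy))
    (Ideal.mul_mem_left _ _ (Ideal.mul_mem_mul hxy hxy))

theorem mem_span_pair_sq {R : Type*} [CommRing R] {x y f : R}
    (hf : f ∈ Ideal.span {x, y} ^ 2) : ∃ A B D, f = y ^ 2 * A + x * y * B + x ^ 2 * D := by
  rw [sq, Ideal.span_pair_mul_span_pair] at hf
  simp only [Ideal.mem_span_insert, Ideal.mem_span_singleton'] at hf
  obtain ⟨a, _, ⟨b, _, ⟨c, _, ⟨d, rfl⟩, rfl⟩, rfl⟩, rfl⟩ := hf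
  exact ⟨d, b + c, a, by ring⟩

/-- An ideal of `ℤ[X]` containing a prime `p` and a monic polynomial is generated by `p` and a
monic polynomial. -/
theorem exists_monic_eq_span_pair {p : ℕ} [Fact p.Prime] {Q : Ideal ℤ[X]}
    (hp : C (p : ℤ) ∈ Q) {f : ℤ[X]} (hf : f.Monic) (hfQ : f ∈ Q) :
    ∃ g : ℤ[X], g.Monic ∧ Q = Ideal.span {C (p : ℤ), g} := by
  set φ := mapRingHom (Int.castRingHom (ZMod p)) with hφ
  have hφs : Function.Surjective φ := map_surjective _ (ZMod.ringHom_surjective _)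
  obtain ⟨d, hd⟩ := (IsPrincipalIdealRing.principal (Ideal.map φ Q)).principal
  change Ideal.map φ Q = Ideal.span {d} at hd
  have hd0 : d ≠ 0 := by
    rintro rfl
    have h1 : φ f ∈ Ideal.map φ Q := Ideal.mem_map_of_mem _ hfQ
    rw [hd, Ideal.mem_span_singleton, zero_dvd_iff] at h1
    exact (hf.map (Int.castRingHom (ZMod p))).ne_zero h1
  have hd' : Ideal.map φ Q = Ideal.span {normalize d} := by
    rw [hd, Ideal.span_singleton_eq_span_singleton]
    exact (normalize_associated d).symm
  obtain ⟨g, hg, -, hgm⟩ := lifts_and_natDegree_eq_and_monic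
    (f := Int.castRingHom (ZMod p)) (p := normalize d)
    ((mem_lifts _).2 (hφs _)) (monic_normalize hd0)
  have key : ∀ q : ℤ[X], φ q = 0 → ∃ r, q = C (p : ℤ) * r := fun q hq =>
    C_dvd_of_map_zmod_eq_zero hq
  refine ⟨g, hgm, le_antisymm (fun q hq => ?_) ?_⟩
  · have h1 : φ q ∈ Ideal.map φ Q := Ideal.mem_map_of_mem _ hq
    rw [hd', Ideal.mem_span_singleton] at h1
    obtain ⟨t, ht⟩ := h1
    obtain ⟨t, rfl⟩ := hφs t
    obtain ⟨r, hr⟩ := key (q - g * t) (by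
      rw [map_sub, map_mul, ht, sub_eq_zero]; congr 1; exact hg.symm)
    rw [Ideal.mem_span_pair]
    exact ⟨r, t, by linear_combination -hr⟩
  · rw [Ideal.span_le]
    rintro q (rfl | rfl)
    · exact hp
    · have h1 : φ q ∈ Ideal.map φ Q := by
        rw [hd', Ideal.mem_span_singleton]; exact dvd_of_eq hg.symm
      obtain ⟨q', hq', h2⟩ := (Ideal.mem_map_iff_of_surjective φ hφs).1 h1
      obtain ⟨r, hr⟩ := key (q - q') (by rw [map_sub, h2, sub_self])
      rw [show q = C (p : ℤ) * r + q' by linear_combination hr]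
      exact add_mem (Ideal.mul_mem_right _ _ hp) hq'

/-- If the conductor of an integral element `α` into `R` is a prime `P = (p, g)`, then `P` is not
locally generated by `p`. -/
theorem false_of_mem_iff_mul_mem_range {R S : Type*} [CommRing R] [CommRing S] [IsDomain S]
    [Algebra R S] (hinj : Function.Injective (algebraMap R S)) {P : Ideal R} [P.IsPrime]
    {α : S} (hα : IsIntegral R α)
    (hP : ∀ r : R, r ∈ P ↔ algebraMap R S r * α ∈ (algebraMap R S).range)
    {p g E A : R} (hspan : P = Ideal.span {p, g}) (hE : E ∉ P) (hg : g ≠ 0)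
    (h : p * E = g * A) : False := by
  have hgP : g ∈ P := hspan ▸ Ideal.subset_span (by simp)
  obtain ⟨y, hy⟩ := (hP g).1 hgP
  have hyP : y ∈ P := by
    obtain ⟨f, hf, hf0⟩ := hα
    have := dvd_pow_natDegree_of_eval₂_eq_zero hinj hf g y α hf0 hy.symm
    exact Ideal.IsPrime.mem_of_pow_mem ‹_› _ (Ideal.mem_of_dvd _ this hgP)
  rw [hspan, Ideal.mem_span_pair] at hyP
  obtain ⟨u, v, huv⟩ := hyP
  have hg0 : algebraMap R S g ≠ 0 := by rwa [Ne, map_eq_zero_iff _ hinj]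
  refine hE ((hP E).2 ⟨v * E + u * A, mul_left_cancel₀ hg0 ?_⟩)
  rw [mul_left_comm _ _ α, ← hy, ← huv]
  simp only [map_add, map_mul]
  have h' := congrArg (algebraMap R S) h
  simp only [map_mul] at h'
  linear_combination -(algebraMap R S u) * h'

theorem index_adjoin_ne_zero {K : Type*} [Field K] [NumberField K]
    {θ : NumberField.RingOfIntegers K} (hgen : Algebra.adjoin ℚ {(θ : K)} = ⊤) :
    (Algebra.adjoin ℤ {θ}).toSubring.toAddSubgroup.index ≠ 0 := by
  set H := (Algebra.adjoin ℤ {θ}).toSubring.toAddSubgroup with hH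
  have : Module.Finite ℤ (NumberField.RingOfIntegers K ⧸ H) :=
    Module.Finite.of_surjective (QuotientAddGroup.mk' H).toIntLinearMap
      (QuotientAddGroup.mk'_surjective H)
  have : Finite (NumberField.RingOfIntegers K ⧸ H) := by
    refine Module.finite_of_fg_torsion _ fun {x} => ?_
    obtain ⟨β, rfl⟩ := QuotientAddGroup.mk'_surjective H x
    have hβ : (β : K) ∈ Algebra.adjoin ℚ {(θ : K)} := hgen ▸ Algebra.mem_top
    rw [Algebra.adjoin_singleton_eq_range_aeval] at hβ
    obtain ⟨q, hq⟩ := hβ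
    obtain ⟨b, hb0, hb⟩ := IsLocalization.integerNormalization_spec (nonZeroDivisors ℤ) q
    refine ⟨⟨b, hb0⟩, ?_⟩
    change b • (QuotientAddGroup.mk' H) β = 0
    rw [← map_zsmul, QuotientAddGroup.mk'_apply, QuotientAddGroup.eq_zero_iff]
    change b • β ∈ Algebra.adjoin ℤ {θ}
    rw [Algebra.adjoin_singleton_eq_range_aeval]
    refine ⟨IsLocalization.integerNormalization (nonZeroDivisors ℤ) q, ?_⟩
    apply NumberField.RingOfIntegers.ext
    have h1 := congrArg (aeval (θ : K)) hb
    rw [aeval_map_algebraMap, map_zsmul] at h1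
    have hq' : aeval (θ : K) q = β := hq
    rw [hq'] at h1
    change algebraMap _ K (aeval θ _) = algebraMap _ K _
    rw [← aeval_algebraMap_apply, h1, map_zsmul]
  exact AddSubgroup.index_ne_zero_of_finite

/-- If `F` lies in the square of a proper ideal containing `p`, then `p` divides the index of
`ℤ[θ]` in the ring of integers. -/
theorem dvd_index_of_mem_sq {K : Type*} [Field K] [NumberField K]
    {θ : NumberField.RingOfIntegers K} {F : ℤ[X]} (hF : F.Monic)
    (hFirr : Irreducible (F.map (algebraMap ℤ ℚ))) (hθ : aeval θ F = 0)
    {p : ℕ} [hp : Fact p.Prime] {Q : Ideal ℤ[X]} (hQ : Q ≠ ⊤) (hpQ : C (p : ℤ) ∈ Q)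
    (hFQ : F ∈ Q ^ 2) :
    p ∣ (Algebra.adjoin ℤ {θ}).toSubring.toAddSubgroup.index := by
  obtain ⟨g, hg, rfl⟩ := exists_monic_eq_span_pair hpQ hF (Ideal.pow_le_self two_ne_zero hFQ)
  obtain ⟨A, B, D, hABD⟩ := mem_span_pair_sq hFQ
  have hgdeg : g.natDegree ≠ 0 := fun h0 => by
    rw [hg.natDegree_eq_zero] at h0
    exact hQ (Ideal.eq_top_of_isUnit_mem _ (Ideal.subset_span (Or.inr rfl)) (h0 ▸ isUnit_one))
  obtain ⟨w, hw⟩ : ∃ w, w = g * A + C (p : ℤ) * B := ⟨_, rfl⟩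
  have hFw : F = g * w + C (p : ℤ) ^ 2 * D := by rw [hABD, hw]; ring
  have hp0 : (p : K) ≠ 0 := Nat.cast_ne_zero.2 hp.out.ne_zero
  set ev : ℤ[X] →ₐ[ℤ] K := aeval (θ : K) with hev
  have hcoe : ∀ f : ℤ[X], ev f = (aeval θ f : NumberField.RingOfIntegers K) := fun f =>
    aeval_algebraMap_apply K θ f
  have hF0 : ev g * ev w + (p : K) ^ 2 * ev D = 0 := by
    have : ev F = 0 := by rw [hcoe, hθ]; exact map_zero _
    rw [hFw] at this
    simpa using this
  have hint : IsIntegral ℤ (ev w / p) := by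
    refine isIntegral_of_smul_mem_submodule (M := K)
      (((Ideal.span {C (p : ℤ), g}).restrictScalars ℤ).map ev.toLinearMap) ?_ ?_ _ ?_
    · intro h0
      have : ev (C (p : ℤ)) ∈ (⊥ : Submodule ℤ K) := h0 ▸ ⟨_, hpQ, rfl⟩
      exact hp0 (by simpa using this)
    · have h1 : ev.toLinearMap = (Algebra.linearMap (NumberField.RingOfIntegers K) K).restrictScalars ℤ
          ∘ₗ (aeval θ).toLinearMap := LinearMap.ext hcoe
      rw [h1, Submodule.map_comp]
      exact Submodule.FG.map _ (IsNoetherian.noetherian _)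
    · rintro _ ⟨q, hq, rfl⟩
      obtain ⟨u, v, rfl⟩ := Ideal.mem_span_pair.1 hq
      refine ⟨u * w - v * (C (p : ℤ) * D), ?_, ?_⟩
      · refine sub_mem (Ideal.mul_mem_left _ _ ?_)
          (Ideal.mul_mem_left _ _ (Ideal.mul_mem_right _ _ hpQ))
        rw [hw]
        exact add_mem (Ideal.mul_mem_right _ _ (Ideal.subset_span (Or.inr rfl)))
          (Ideal.mul_mem_right _ _ hpQ)
      · simp only [AlgHom.toLinearMap_apply, map_sub, map_mul, map_add, smul_eq_mul]
        have hC : ev (C (p : ℤ)) = p := by simp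
        rw [hC]
        field_simp
        linear_combination -(ev v) * hF0
  obtain ⟨β, hβ⟩ : ∃ β : NumberField.RingOfIntegers K, algebraMap _ K β = ev w / p := ⟨⟨_, hint⟩, rfl⟩
  have hpβ : (p : NumberField.RingOfIntegers K) * β = aeval θ w := by
    apply NumberField.RingOfIntegers.ext
    rw [← hcoe]
    change algebraMap _ K (_ * β) = _
    rw [map_mul, map_natCast, hβ]
    field_simp
  have hβR : β ∉ Algebra.adjoin ℤ {θ} := by
    rw [Algebra.adjoin_singleton_eq_range_aeval]
    rintro ⟨r, hr⟩
    have hr' : aeval θ r = β := hr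
    have h0 : ev (w - C (p : ℤ) * r) = 0 := by
      rw [hcoe]; simp [← hpβ, hr']
    have hdvd : F ∣ w - C (p : ℤ) * r := by
      rw [IsPrimitive.Int.dvd_iff_map_cast_dvd_map_cast _ _ hF.isPrimitive]
      have hmin : F.map (algebraMap ℤ ℚ) = minpoly ℚ (θ : K) :=
        minpoly.eq_of_irreducible_of_monic hFirr
          (by rw [aeval_map_algebraMap, ← hev, hcoe, hθ]; exact map_zero _) (hF.map _)
      change F.map (algebraMap ℤ ℚ) ∣ (w - C (p : ℤ) * r).map (algebraMap ℤ ℚ)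
      rw [hmin]
      exact minpoly.dvd _ _ (by rw [aeval_map_algebraMap, ← hev, h0])
    have h2 := Polynomial.map_dvd (Int.castRingHom (ZMod p)) hdvd
    have hFm := congrArg (Polynomial.map (Int.castRingHom (ZMod p))) hFw
    simp at h2 hFm
    have hw0 : w.map (Int.castRingHom (ZMod p)) ≠ 0 := fun h => by
      rw [h, mul_zero] at hFm
      exact (hF.map (Int.castRingHom (ZMod p))).ne_zero hFm
    have h3 := natDegree_le_of_dvd h2 hw0
    rw [hFm, natDegree_mul (hg.map _).ne_zero hw0, hg.natDegree_map] at h3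
    omega
  set H := (Algebra.adjoin ℤ {θ}).toSubring.toAddSubgroup with hH
  have hord : addOrderOf (QuotientAddGroup.mk' H β) = p := by
    refine addOrderOf_eq_prime ?_ ?_
    · rw [← map_nsmul, QuotientAddGroup.mk'_apply, QuotientAddGroup.eq_zero_iff, nsmul_eq_mul, hpβ]
      exact aeval_mem_adjoin_singleton ℤ θ
    · rw [QuotientAddGroup.mk'_apply, Ne, QuotientAddGroup.eq_zero_iff]
      exact hβR
  rw [← hord]
  exact addOrderOf_dvd_natCard _

/-- If `p` divides the index of `ℤ[θ]` in the ring of integers, then `F` lies in the square of a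
prime ideal containing `p`. -/
theorem exists_mem_sq_of_dvd_index {K : Type*} [Field K] [NumberField K]
    {θ : NumberField.RingOfIntegers K} {F : ℤ[X]} (hF : F.Monic)
    (hgen : Algebra.adjoin ℚ {(θ : K)} = ⊤) (hθ : aeval θ F = 0)
    {p : ℕ} [hp : Fact p.Prime]
    (hdvd : p ∣ (Algebra.adjoin ℤ {θ}).toSubring.toAddSubgroup.index) :
    ∃ Q : Ideal ℤ[X], Q.IsPrime ∧ C (p : ℤ) ∈ Q ∧ F ∈ Q ^ 2 := by
  set R := Algebra.adjoin ℤ {θ} with hR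
  set H := R.toSubring.toAddSubgroup with hH
  have : H.FiniteIndex := ⟨index_adjoin_ne_zero hgen⟩
  have hfin : Finite (NumberField.RingOfIntegers K ⧸ H) :=
    AddSubgroup.finite_quotient_of_finiteIndex
  obtain ⟨x, hx⟩ := exists_prime_addOrderOf_dvd_card' p hdvd
  obtain ⟨β, rfl⟩ := QuotientAddGroup.mk'_surjective H x
  have hβ : β ∉ R := fun h => by
    have : QuotientAddGroup.mk' H β = 0 := (QuotientAddGroup.eq_zero_iff β).2 h
    rw [this, addOrderOf_zero] at hx
    exact hp.out.one_lt.ne hx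
  have hpβ : (p : NumberField.RingOfIntegers K) * β ∈ R := by
    have h1 := addOrderOf_nsmul_eq_zero (QuotientAddGroup.mk' H β)
    rw [hx, ← map_nsmul, QuotientAddGroup.mk'_apply, QuotientAddGroup.eq_zero_iff,
      nsmul_eq_mul] at h1
    exact h1
  set ev : ℤ[X] →ₐ[ℤ] R := aeval ⟨θ, Algebra.self_mem_adjoin_singleton ℤ θ⟩ with hev
  have hcoe : ∀ f : ℤ[X], (ev f : NumberField.RingOfIntegers K) = aeval θ f := fun f =>
    (aeval_algebraMap_apply (NumberField.RingOfIntegers K)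
      (⟨θ, Algebra.self_mem_adjoin_singleton ℤ θ⟩ : R) f).symm
  have hevs : Function.Surjective ev := by
    rintro ⟨y, hy⟩
    have hy' := hy
    rw [hR, Algebra.adjoin_singleton_eq_range_aeval] at hy'
    obtain ⟨f, hf⟩ := hy'
    exact ⟨f, Subtype.ext ((hcoe f).trans hf)⟩
  have : IsNoetherianRing R := isNoetherianRing_of_surjective _ _ ev.toRingHom hevs
  set N : Submodule R (NumberField.RingOfIntegers K) := LinearMap.range (Algebra.linearMap R _)
  have hN : ∀ y, y ∈ N ↔ y ∈ (algebraMap R (NumberField.RingOfIntegers K)).range := fun y => Iff.rfl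
  have hNR : ∀ y, y ∈ N ↔ y ∈ R := fun y =>
    ⟨by rintro ⟨r, rfl⟩; exact r.2, fun h => ⟨⟨y, h⟩, rfl⟩⟩
  have hmk : ∀ (r : R) (y : NumberField.RingOfIntegers K),
      r • N.mkQ y = 0 ↔ algebraMap R _ r * y ∈ N := fun r y => by
    rw [← map_smul, Submodule.mkQ_apply, Submodule.Quotient.mk_eq_zero, Algebra.smul_def]
  obtain ⟨P, hPass, hle⟩ := exists_le_isAssociatedPrime_of_isNoetherianRing R (N.mkQ β)
    (by rwa [Submodule.mkQ_apply, Ne, Submodule.Quotient.mk_eq_zero, hNR])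
  obtain ⟨hPp, x, hPx⟩ := isAssociatedPrime_iff.1 hPass
  obtain ⟨α, rfl⟩ := N.mkQ_surjective x
  have hP : ∀ r : R, r ∈ P ↔
      algebraMap R (NumberField.RingOfIntegers K) r * α ∈
        (algebraMap R (NumberField.RingOfIntegers K)).range := fun r => by
    rw [hPx, Submodule.mem_colon_singleton, Submodule.mem_bot, hmk, hN]
  have hpP : (p : R) ∈ P := hle (by
    rw [Submodule.mem_colon_singleton, Submodule.mem_bot, hmk, hNR, map_natCast]
    exact hpβ)
  have hevF : ev F = 0 := Subtype.ext (by rw [hcoe, hθ]; rfl)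
  have hevp : ev (C (p : ℤ)) = p := by simp
  set Q := P.comap ev with hQ
  have hpQ : C (p : ℤ) ∈ Q := by rw [hQ, Ideal.mem_comap, hevp]; exact hpP
  have hFQ : F ∈ Q := by rw [hQ, Ideal.mem_comap, hevF]; exact P.zero_mem
  have hQprime : Q.IsPrime := Ideal.comap_isPrime _ _
  refine ⟨Q, hQprime, hpQ, ?_⟩
  obtain ⟨g, hg, hQg⟩ := exists_monic_eq_span_pair hpQ hF hFQ
  have hPspan : P = Ideal.span {(p : R), ev g} := by
    rw [← Ideal.map_comap_of_surjective ev hevs P, ← hQ, hQg, Ideal.map_span, Set.image_pair, hevp]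
  have hgQ : g ∈ Q := hQg ▸ Ideal.subset_span (Or.inr rfl)
  have hFspan := hFQ
  rw [hQg, Ideal.mem_span_pair] at hFspan
  obtain ⟨E, B, hEB⟩ := hFspan
  have hrel : (p : R) * ev E = ev g * -ev B := by
    have h1 := congrArg ev hEB
    rw [hevF, map_add, map_mul, map_mul, hevp] at h1
    linear_combination h1
  have hα : IsIntegral R α := (NumberField.RingOfIntegers.isIntegral α).tower_top
  have hinj : Function.Injective (algebraMap R (NumberField.RingOfIntegers K)) :=
    Subtype.val_injective
  have hp0 : (p : R) ≠ 0 := Nat.cast_ne_zero.2 hp.out.ne_zero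
  have hEQ : E ∈ Q := by
    by_contra hE
    refine false_of_mem_iff_mul_mem_range hinj hα hP hPspan hE ?_ hrel
    intro h0
    rw [h0, zero_mul] at hrel
    rcases mul_eq_zero.1 hrel with h | h
    · exact hp0 h
    · exact hE (by rw [hQ, Ideal.mem_comap, h]; exact P.zero_mem)
  have hBQ : B ∈ Q := by
    by_contra hB
    refine false_of_mem_iff_mul_mem_range hinj hα hP (hPspan.trans (by rw [Set.pair_comm])) hB hp0
      (A := -ev E) (by linear_combination hrel)
  rw [← hEB, sq]
  exact add_mem (Ideal.mul_mem_mul hEQ hpQ) (Ideal.mul_mem_mul hBQ hgQ)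

theorem charP_quotient_of_mem {p : ℕ} (hp : p.Prime) {Q : Ideal ℤ[X]} [Q.IsPrime]
    (hpQ : C (p : ℤ) ∈ Q) : CharP (ℤ[X] ⧸ Q) p := by
  refine (CharP.charP_iff_prime_eq_zero hp).2 ?_
  have := Ideal.Quotient.eq_zero_iff_mem.2 hpQ
  simpa using this

theorem intCast_pow_char_pow {L : Type*} [CommRing L] {p : ℕ} [Fact p.Prime] [CharP L p]
    (m : ℕ) (b : ℤ) : (b : L) ^ p ^ m = b := by
  rw [← iterateFrobenius_def, map_intCast]

theorem C_dvd_X_pow_add_sub {p : ℕ} [Fact p.Prime] (j s' : ℕ) (b : ℤ) :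
    C (p : ℤ) ∣ (X ^ (p ^ j * s') + C b) - (X ^ s' + C b) ^ p ^ j := by
  refine C_dvd_of_map_zmod_eq_zero ?_
  simp only [Polynomial.map_sub, Polynomial.map_add, Polynomial.map_pow, map_X, eq_intCast,
    Polynomial.map_intCast, add_pow_char_pow, ← pow_mul, mul_comm s', intCast_pow_char_pow,
    sub_self]

theorem sum_Icc_pow_sub_succ {R : Type*} [CommSemiring R] (x : R) (n : ℕ) :
    ∑ i ∈ Finset.Icc 1 (n + 1), x ^ (n + 1 - i) =
      x * ∑ i ∈ Finset.Icc 1 n, x ^ (n - i) + 1 := by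
  rw [Finset.sum_Icc_succ_top (by omega), Nat.sub_self, pow_zero, Finset.mul_sum]
  congr 1
  refine Finset.sum_congr rfl fun i hi => ?_
  rw [Finset.mem_Icc] at hi
  rw [← pow_succ', Nat.sub_add_comm hi.2]

/-- Modulo the square of an ideal containing `p` and `(X ^ s' + b) ^ s + c`, the polynomial `F` is
`p (c₂ + c a₁ (X ^ k + b))`. -/
theorem sub_C_mul_mem_sq {p : ℕ} [Fact p.Prime] {n k i j s s' : ℕ} {a b c a₁ c₂ : ℤ}
    (hn : 2 ≤ n) (hpn : p ∣ n) (hpq : p ∣ p ^ (i + j))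
    (hks : k = p ^ j * s') (hns : n = p ^ i * s) (ha₁ : a = p * a₁)
    (hc₂ : (p : ℤ) * c₂ = c + (-c) ^ p ^ (i + j)) {Q : Ideal ℤ[X]} (hpQ : C (p : ℤ) ∈ Q)
    (hh : (X ^ s' + C b) ^ s + C c ∈ Q) :
    (X ^ k + C b) ^ n + C c * ∑ i ∈ Finset.Icc 1 n, (C a * (X ^ k + C b)) ^ (n - i) -
      C (p : ℤ) * (C c₂ + C c * C a₁ * (X ^ k + C b)) ∈ Q ^ 2 := by
  have hcast : ∀ m : ℕ, p ∣ m → (m : ℤ[X]) ∈ Q := by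
    rintro _ ⟨m, rfl⟩
    rw [Nat.cast_mul]
    exact Ideal.mul_mem_right _ _ (by simpa using hpQ)
  have h1 : (X ^ k + C b) ^ n - ((X ^ s' + C b) ^ p ^ j) ^ n ∈ Q ^ 2 :=
    pow_sub_pow_mem_sq (Ideal.mem_of_dvd _ (hks ▸ C_dvd_X_pow_add_sub j s' b) hpQ) (hcast _ hpn)
  have h2 : ((X ^ s' + C b) ^ s) ^ p ^ (i + j) - (-C c) ^ p ^ (i + j) ∈ Q ^ 2 :=
    pow_sub_pow_mem_sq (by rwa [sub_neg_eq_add]) (hcast _ hpq)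
  have h3 : ((X ^ s' + C b) ^ p ^ j) ^ n = (((X ^ s' + C b) ^ s) ^ p ^ (i + j) : ℤ[X]) := by
    rw [hns, ← pow_mul, ← pow_mul, pow_add]; congr 1; ring
  have h4 : ∑ i ∈ Finset.Icc 1 n, (C a * (X ^ k + C b)) ^ (n - i) - 1 - C a * (X ^ k + C b)
      ∈ Q ^ 2 := by
    have hu : C a * (X ^ k + C b) ∈ Q := by
      rw [ha₁, C_mul, mul_assoc]
      exact Ideal.mul_mem_right _ _ hpQ
    obtain ⟨m, rfl⟩ := Nat.exists_eq_add_of_le' hn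
    have h (x : ℤ[X]) : x * (x * ∑ i ∈ Finset.Icc 1 m, x ^ (m - i) + 1) + 1 - 1 - x =
        x * x * ∑ i ∈ Finset.Icc 1 m, x ^ (m - i) := by ring
    rw [sum_Icc_pow_sub_succ, sum_Icc_pow_sub_succ, h, sq]
    exact Ideal.mul_mem_right _ _ (Ideal.mul_mem_mul hu hu)
  have h5 : C (p : ℤ) * C c₂ = C c + (-C c) ^ p ^ (i + j) := by
    rw [← C_mul, hc₂]; simp
  have h6 : C a = C (p : ℤ) * C a₁ := by rw [ha₁, C_mul]
  rw [h3] at h1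
  have h7 := add_mem (add_mem h1 h2) (Ideal.mul_mem_left _ (C c) h4)
  convert h7 using 1
  linear_combination -h5 + C c * (X ^ k + C b) * h6

theorem radical_mem_of_mem {p : ℕ} [hp : Fact p.Prime] {n k i j s s' : ℕ} {a b c : ℤ}
    (hks : k = p ^ j * s') (hns : n = p ^ i * s) (hpa : (p : ℤ) ∣ a) (hn : n ≠ 0)
    {Q : Ideal ℤ[X]} [hQ : Q.IsPrime] (hpQ : C (p : ℤ) ∈ Q)
    (hF : (X ^ k + C b) ^ n + C c * ∑ i ∈ Finset.Icc 1 n, (C a * (X ^ k + C b)) ^ (n - i) ∈ Q) :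
    (X ^ s' + C b) ^ s + C c ∈ Q := by
  have := charP_quotient_of_mem hp.out hpQ
  rw [← Ideal.Quotient.eq_zero_iff_mem] at hF ⊢
  have hz : Ideal.Quotient.mk Q (C a) = 0 := by
    rw [Ideal.Quotient.eq_zero_iff_mem]
    exact Ideal.mem_of_dvd _ ((C_dvd_iff_dvd_coeff _ _).2 fun m => by
      rw [coeff_C]; split_ifs <;> simp [hpa]) hpQ
  have hC : ∀ m : ℤ, Ideal.Quotient.mk Q (C m) = m := fun m => by simp
  have hu : Ideal.Quotient.mk Q (X ^ k + C b) = (Ideal.Quotient.mk Q (X ^ s' + C b)) ^ p ^ j := by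
    rw [← map_pow, ← sub_eq_zero, ← map_sub, Ideal.Quotient.eq_zero_iff_mem]
    exact Ideal.mem_of_dvd _ (hks ▸ C_dvd_X_pow_add_sub j s' b) hpQ
  have hsum : Ideal.Quotient.mk Q
      (∑ i ∈ Finset.Icc 1 n, (C a * (X ^ k + C b)) ^ (n - i)) = 1 := by
    rw [map_sum, Finset.sum_eq_single n]
    · simp
    · intro m hm hmn
      rw [Finset.mem_Icc] at hm
      rw [map_pow, map_mul, hz, zero_mul, zero_pow (by omega)]
    · intro h; simp at h; omega
  rw [map_add, map_mul, hsum, hC, mul_one, map_pow, hu] at hF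
  rw [map_add, map_pow, hC]
  refine eq_zero_of_pow_eq_zero (n := p ^ (i + j)) ?_
  rw [add_pow_char_pow, intCast_pow_char_pow, ← hF, hns]
  congr 1
  rw [← pow_mul, ← pow_mul, pow_add]; congr 1; ring

theorem dvd_of_common_root {p : ℕ} [hp : Fact p.Prime] {L : Type*} [CommRing L] [IsDomain L]
    [CharP L p] {n i j s : ℕ} {c a₁ c₂ : ℤ} {y : L} (hns : n = p ^ i * s)
    (hy : y ^ s + c = 0) (hv : c₂ + c * a₁ * y ^ p ^ j = 0) :
    (p : ℤ) ∣ c ^ (n + 1) * a₁ ^ n + (-c₂) ^ n := by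
  rw [← CharP.intCast_eq_zero_iff L p]
  have hz : (y ^ p ^ j) ^ n = -c := by
    calc (y ^ p ^ j) ^ n = (y ^ s) ^ p ^ (i + j) := by
          rw [hns, ← pow_mul, ← pow_mul, pow_add]; congr 1; ring
      _ = ((-c : ℤ) : L) ^ p ^ (i + j) := by
          rw [eq_neg_of_add_eq_zero_left hy]; push_cast; rfl
      _ = -c := by rw [intCast_pow_char_pow]; push_cast; rfl
  have h1 : (-c₂ : L) = c * a₁ * y ^ p ^ j := by linear_combination -hv
  push_cast
  rw [h1, mul_pow, hz, mul_pow]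
  ring

theorem exists_common_root {p : ℕ} [hp : Fact p.Prime] {L : Type*} [Field L] [IsAlgClosed L]
    [CharP L p] {n i j s : ℕ} {c a₁ c₂ : ℤ} (hs : 0 < s) (hc : ¬ (p : ℤ) ∣ c)
    (hns : n = p ^ i * s)
    (h : (p : ℤ) ∣ c ^ (n + 1) * a₁ ^ n + (-c₂) ^ n) :
    ∃ y : L, y ^ s + c = 0 ∧ c₂ + c * a₁ * y ^ p ^ j = 0 := by
  have hn : n ≠ 0 := by rw [hns]; exact mul_ne_zero (pow_ne_zero _ hp.out.ne_zero) hs.ne'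
  have hc0 : (c : L) ≠ 0 := by rwa [Ne, CharP.intCast_eq_zero_iff L p]
  rw [← CharP.intCast_eq_zero_iff L p] at h
  push_cast at h
  by_cases ha : (a₁ : L) = 0
  · obtain ⟨y, hy⟩ := IsAlgClosed.exists_pow_nat_eq (-(c : L)) hs
    have : (c₂ : L) = 0 := by simpa [ha, hn] using h
    exact ⟨y, by rw [hy]; ring, by rw [this, ha]; ring⟩
  · obtain ⟨y, hy⟩ := IsAlgClosed.exists_pow_nat_eq (-(c₂ : L) / (c * a₁))
      (n := p ^ j) (pow_pos hp.out.pos _)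
    refine ⟨y, ?_, by rw [hy]; field_simp; ring⟩
    refine eq_zero_of_pow_eq_zero (n := p ^ (i + j)) ?_
    rw [add_pow_char_pow, intCast_pow_char_pow]
    calc (y ^ s) ^ p ^ (i + j) + c = (y ^ p ^ j) ^ n + c := by
          rw [hns, ← pow_mul, ← pow_mul, pow_add]; congr 2; ring
      _ = 0 := by
          rw [hy, div_pow, mul_pow]
          field_simp
          linear_combination h

theorem exists_prime_mem_iff_dvd {p : ℕ} [hp : Fact p.Prime] {n k i j s s' : ℕ} {b c a₁ c₂ : ℤ}
    (hs : 0 < s) (hs' : 0 < s') (hc : ¬ (p : ℤ) ∣ c) (hks : k = p ^ j * s')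
    (hns : n = p ^ i * s) :
    (∃ Q : Ideal ℤ[X], Q.IsPrime ∧ C (p : ℤ) ∈ Q ∧ (X ^ s' + C b) ^ s + C c ∈ Q ∧
      C c₂ + C c * C a₁ * (X ^ k + C b) ∈ Q) ↔
      (p : ℤ) ∣ c ^ (n + 1) * a₁ ^ n + (-c₂) ^ n := by
  constructor
  · rintro ⟨Q, hQ, hpQ, hh, hv⟩
    have := charP_quotient_of_mem hp.out hpQ
    have hC : ∀ m : ℤ, Ideal.Quotient.mk Q (C m) = m := fun m => by simp
    have hu : Ideal.Quotient.mk Q (X ^ k + C b) =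
        (Ideal.Quotient.mk Q (X ^ s' + C b)) ^ p ^ j := by
      rw [← map_pow, ← sub_eq_zero, ← map_sub, Ideal.Quotient.eq_zero_iff_mem]
      exact Ideal.mem_of_dvd _ (hks ▸ C_dvd_X_pow_add_sub j s' b) hpQ
    rw [← Ideal.Quotient.eq_zero_iff_mem] at hh hv
    rw [map_add, map_pow, hC] at hh
    rw [map_add, map_mul, map_mul, hu, hC, hC, hC] at hv
    exact dvd_of_common_root hns hh hv
  · intro h
    obtain ⟨y, hy, hv⟩ := exists_common_root (L := AlgebraicClosure (ZMod p)) (j := j) hs hc hns h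
    obtain ⟨x, hx⟩ := IsAlgClosed.exists_pow_nat_eq (y - b) hs'
    have hxk : x ^ k + b = y ^ p ^ j := by
      rw [hks, mul_comm, pow_mul, hx, sub_pow_char_pow, intCast_pow_char_pow, sub_add_cancel]
    set ψ := eval₂RingHom (Int.castRingHom (AlgebraicClosure (ZMod p))) x
    have hC : ∀ m : ℤ, ψ (C m) = m := fun m => by simp
    have hX : ψ X = x := eval₂_X _ _
    refine ⟨RingHom.ker ψ, RingHom.ker_isPrime _, ?_, ?_, ?_⟩
    · simp [RingHom.mem_ker]
    · simp only [RingHom.mem_ker, map_add, map_pow, hC, hX, hx, sub_add_cancel, hy]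
    · simp only [RingHom.mem_ker, map_add, map_mul, map_pow, hC, hX, hxk, hv]

theorem mem_of_C_mul_mem_sq {p : ℕ} [hp : Fact p.Prime] {Q : Ideal ℤ[X]} (hpQ : C (p : ℤ) ∈ Q)
    {f v : ℤ[X]} (hf : f.Monic) (hfQ : f ∈ Q) (hv : C (p : ℤ) * v ∈ Q ^ 2) : v ∈ Q := by
  obtain ⟨g, hg, rfl⟩ := exists_monic_eq_span_pair hpQ hf hfQ
  obtain ⟨A, B, D, h⟩ := mem_span_pair_sq hv
  have hp0 : (C (p : ℤ) : ℤ[X]) ≠ 0 := by simp [hp.out.ne_zero]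
  obtain ⟨A', rfl⟩ : C (p : ℤ) ∣ A := by
    refine C_dvd_of_map_zmod_eq_zero ?_
    have h1 := congrArg (Polynomial.map (Int.castRingHom (ZMod p))) h
    simp at h1
    exact h1.resolve_left (hg.map (Int.castRingHom (ZMod p))).ne_zero
  have : v = g * A' * g + g * B + C (p : ℤ) * D :=
    mul_left_cancel₀ hp0 (by linear_combination h)
  rw [this]
  have hgQ : g ∈ Ideal.span {C (p : ℤ), g} := Ideal.subset_span (Or.inr rfl)
  exact add_mem (add_mem (Ideal.mul_mem_left _ _ hgQ) (Ideal.mul_mem_right _ _ hgQ))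
    (Ideal.mul_mem_right _ _ hpQ)

theorem monic_pow_add_sum {n k : ℕ} (hn : n ≠ 0) (hk : k ≠ 0) (a b c : ℤ) :
    ((X ^ k + C b) ^ n +
      C c * ∑ i ∈ Finset.Icc 1 n, (C a * (X ^ k + C b)) ^ (n - i) : ℤ[X]).Monic := by
  have hm : (X ^ k + C b : ℤ[X]).Monic := monic_X_pow_add_C b hk
  have hd : (X ^ k + C b : ℤ[X]).natDegree = k := natDegree_X_pow_add_C
  refine (hm.pow n).add_of_left (degree_lt_degree ?_)
  rw [hm.natDegree_pow, hd]
  refine lt_of_le_of_lt (natDegree_C_mul_le _ _)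
    (lt_of_le_of_lt (natDegree_sum_le_of_forall_le (n := (n - 1) * k) _ _ fun m hm' => ?_)
      (Nat.mul_lt_mul_of_pos_right (by omega) (by omega)))
  rw [Finset.mem_Icc] at hm'
  refine natDegree_pow_le.trans (Nat.mul_le_mul (by omega) ?_)
  exact (natDegree_C_mul_le _ _).trans hd.le

theorem stmt_5
    (n k : ℕ) (hn : 3 ≤ n) (hk : 1 ≤ k) (a b c : ℤ)
    (F : Polynomial ℤ)
    (hF : F = (X ^ k + C b) ^ n +
        C c * ∑ i ∈ Finset.Icc 1 n, (C a * (X ^ k + C b)) ^ (n - i))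
    (hFdeg : F.natDegree = n * k)
    (hFirr : Irreducible (F.map (algebraMap ℤ ℚ)))
    (K : Type*) [Field K] [NumberField K]
    (θ : NumberField.RingOfIntegers K)
    (hθ : aeval θ F = 0)
    (hgen : Algebra.adjoin ℚ {(θ : K)} = ⊤)
    (D : ℤ) (hD : IsDiscriminant F D)
    (p : ℕ) (hp : p.Prime) (hpD : (p : ℤ) ∣ D)
    (hpc : ¬ (p : ℤ) ∣ c) (hpk : p ∣ k) (hpa : (p : ℤ) ∣ a) (hpn : p ∣ n)
    (j s' : ℕ) (hks : k = p ^ j * s') (hps' : ¬ p ∣ s')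
    (i s : ℕ) (hns : n = p ^ i * s) (hps : ¬ p ∣ s)
    (a₁ c₂ : ℤ) (ha₁ : a = (p : ℤ) * a₁)
    (hc₂ : (p : ℤ) * c₂ = c + (-c) ^ p ^ (i + j)) :
    (¬ p ∣ (Algebra.adjoin ℤ {θ}).toSubring.toAddSubgroup.index) ↔
      ¬ (p : ℤ) ∣ (c ^ (n + 1) * a₁ ^ n + (-c₂) ^ n) := by
  have : Fact p.Prime := ⟨hp⟩
  have hn0 : n ≠ 0 := by omega
  have hmonic : F.Monic := hF ▸ monic_pow_add_sum hn0 (by omega) a b c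
  have hs : 0 < s := Nat.pos_of_ne_zero fun h => hps (h ▸ dvd_zero p)
  have hs' : 0 < s' := Nat.pos_of_ne_zero fun h => hps' (h ▸ dvd_zero p)
  have hi : i ≠ 0 := by
    rintro rfl
    rw [pow_zero, one_mul] at hns
    exact hps (hns ▸ hpn)
  have hpq : p ∣ p ^ (i + j) := dvd_pow_self p (by omega)
  refine not_congr ?_
  rw [← exists_prime_mem_iff_dvd (b := b) hs hs' hpc hks hns]
  constructor
  · intro h
    obtain ⟨Q, hQ, hpQ, hFQ⟩ := exists_mem_sq_of_dvd_index hmonic hgen hθ h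
    have hFQ' : F ∈ Q := Ideal.pow_le_self two_ne_zero hFQ
    have hhQ := radical_mem_of_mem hks hns hpa hn0 hpQ (hF ▸ hFQ')
    have hsub := sub_C_mul_mem_sq (by omega) hpn hpq hks hns ha₁ hc₂ hpQ hhQ
    rw [← hF] at hsub
    exact ⟨Q, hQ, hpQ, hhQ, mem_of_C_mul_mem_sq hpQ hmonic hFQ' (((Submodule.sub_mem_iff_right _ hFQ).1 hsub))⟩
  · rintro ⟨Q, hQ, hpQ, hhQ, hvQ⟩
    have hsub := sub_C_mul_mem_sq (by omega) hpn hpq hks hns ha₁ hc₂ hpQ hhQ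
    rw [← hF] at hsub
    refine dvd_index_of_mem_sq hmonic hFirr hθ hQ.ne_top hpQ ?_
    refine (Submodule.sub_mem_iff_left _ ?_).1 hsub
    rw [sq]
    exact Ideal.mul_mem_mul hpQ hvQ
end

section
/- Let F(x) = (x^k + b)^n + c·∑_{i=1}^{n} (a(x^k + b))^{n-i} ∈ ℤ[x] be irreducible of degree nk over ℚ, let θ be a root of F, and K = ℚ(θ). Let p be a prime divisor of the discriminant 𝔇_F with p ∤ ck, p ∣ a and p ∣ n; write n = p^j s with p ∤ s, and set a₁ = a/p and c₂ = (c + (−c)^{p^j})/p. Then p does not divide the index [ℤ_K : ℤ[θ]] if and only if p ∤ ((−c₂)^s + c·(c a₁)^s). -/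
open Polynomial

/-- Saturation at `p` of a Noetherian domain `A` in an integral extension, provided every prime of
`A` above `p` is locally principal. -/
theorem mem_range_of_mul_mem_range {A B : Type*} [CommRing A] [IsNoetherianRing A] [CommRing B]
    [IsDomain B] [Algebra A B] [FaithfulSMul A B] [Algebra.IsIntegral A B] (p : A) (hp : p ≠ 0)
    (h : ∀ P : Ideal A, P.IsPrime → p ∈ P →
      ∃ φ ∈ P, ∃ u ∉ P, φ ∣ p * u ∧ P ≤ Ideal.span {φ, p})
    (x : B) (hx : algebraMap A B p * x ∈ (algebraMap A B).range) :
    x ∈ (algebraMap A B).range := by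
  have hinj : Function.Injective (algebraMap A B) := FaithfulSMul.algebraMap_injective A B
  by_contra hxA
  let N : Submodule A B := 1
  have hN (z : B) : z ∈ N ↔ z ∈ (algebraMap A B).range := by
    simp [N, Submodule.mem_one]
  have hx0 : N.mkQ x ≠ 0 := by
    rwa [Submodule.mkQ_apply, Ne, Submodule.Quotient.mk_eq_zero, hN]
  obtain ⟨P, hP, hle⟩ := exists_le_isAssociatedPrime_of_isNoetherianRing A _ hx0
  obtain ⟨hPp, y', hy'⟩ := (isAssociatedPrime_iff).1 hP
  obtain ⟨y, rfl⟩ := N.mkQ_surjective y'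
  have key (w : B) (z : A) : z ∈ (⊥ : Submodule A (B ⧸ N)).colon {N.mkQ w} ↔
      algebraMap A B z * w ∈ (algebraMap A B).range := by
    rw [Submodule.mem_colon_singleton, Submodule.mem_bot, ← map_smul, Submodule.mkQ_apply,
      Submodule.Quotient.mk_eq_zero, hN, Algebra.smul_def]
  have hPm (z : A) : z ∈ P ↔ algebraMap A B z * y ∈ (algebraMap A B).range := by
    rw [hy', key]
  have hpP : p ∈ P := hle ((key x p).2 hx)
  obtain ⟨φ, hφ, u, hu, ⟨v, hv⟩, hspan⟩ := h P hPp hpP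
  obtain ⟨w, hw⟩ := (hPm φ).1 hφ
  have hwP : w ∈ P := by
    obtain ⟨m, hm, hmy⟩ := Algebra.IsIntegral.isIntegral (R := A) y
    have hroot : (m.scaleRoots φ).eval w = 0 := by
      apply hinj
      have := scaleRoots_eval₂_mul (p := m) (algebraMap A B) (s := φ) (r := y)
      rw [← eval₂_at_apply, hw, this, hmy, mul_zero, map_zero]
    have := congrArg (Ideal.Quotient.mk P) hroot
    rw [← eval₂_at_apply, ← eval_map, map_zero] at this
    have hφ0 : Ideal.Quotient.mk P φ = 0 := Ideal.Quotient.eq_zero_iff_mem.2 hφ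
    rw [Polynomial.map_scaleRoots _ _ _ (by
      rw [hm.leadingCoeff, map_one]
      have := Ideal.Quotient.nontrivial_iff.2 hPp.ne_top
      exact one_ne_zero), hφ0, scaleRoots_zero] at this
    rw [hm.map] at this
    simp only [one_smul, eval_pow, eval_X] at this
    exact Ideal.Quotient.eq_zero_iff_mem.1 (eq_zero_of_pow_eq_zero this)
  obtain ⟨α, β, hαβ⟩ := Ideal.mem_span_pair.1 (hspan hwP)
  have hφ0 : φ ≠ 0 := by
    rintro rfl
    have : algebraMap A B p * algebraMap A B u = 0 := by
      rw [← map_mul, hv, zero_mul, map_zero]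
    rcases mul_eq_zero.1 this with h0 | h0
    · exact hp (hinj (h0.trans (map_zero _).symm))
    · exact hu ((hinj (h0.trans (map_zero _).symm)) ▸ P.zero_mem)
  apply hu
  rw [hPm]
  refine ⟨u * α + β * v, ?_⟩
  have hφB : algebraMap A B φ ≠ 0 := fun h0 ↦ hφ0 (hinj (h0.trans (map_zero _).symm))
  apply mul_left_cancel₀ hφB
  rw [mul_left_comm, ← hw, ← hαβ, ← map_mul, ← map_mul]
  congr 1
  linear_combination -β * hv

theorem C_dvd_iff_map_castRingHom_eq_zero (p : ℕ) (f : ℤ[X]) :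
    C (p : ℤ) ∣ f ↔ f.map (Int.castRingHom (ZMod p)) = 0 := by
  rw [C_dvd_iff_dvd_coeff]
  simp [Polynomial.ext_iff, ZMod.intCast_zmod_eq_zero_iff_dvd]

theorem exists_generator_modulo_prime (p : ℕ) [Fact p.Prime] (I : Ideal ℤ[X]) :
    ∃ φ ∈ I, ∀ h ∈ I, ∃ q w : ℤ[X], h = φ * q + C (p : ℤ) * w := by
  let r := mapRingHom (Int.castRingHom (ZMod p))
  have hr : Function.Surjective r := map_surjective _ (ZMod.ringHom_surjective _)
  obtain ⟨d, hd⟩ := IsPrincipalIdealRing.principal (I.map r)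
  have hdI : d ∈ I.map r := hd ▸ Ideal.mem_span_singleton_self d
  obtain ⟨φ, hφ, rfl⟩ := (Ideal.mem_map_iff_of_surjective r hr).1 hdI
  refine ⟨φ, hφ, fun h hh ↦ ?_⟩
  have : r h ∈ Ideal.span {r φ} := by
    rw [← Ideal.submodule_span_eq, ← hd]
    exact Ideal.mem_map_of_mem r hh
  obtain ⟨q', hq⟩ := Ideal.mem_span_singleton.1 this
  obtain ⟨q, rfl⟩ := hr q'
  obtain ⟨w, hw⟩ := (C_dvd_iff_map_castRingHom_eq_zero p (h - φ * q)).2 (by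
    change r _ = 0
    rw [map_sub, map_mul, hq, sub_self])
  exact ⟨q, w, by rw [← hw]; ring⟩

/-- One half of Dedekind's criterion: if `g ^ e + p M` vanishes at `θ`, `2 ≤ e`, and `g`, `M` are
coprime modulo `p`, then `ℤ[θ]` is `p`-saturated. -/
theorem mem_adjoin_of_isCoprime {B : Type*} [CommRing B] [IsDomain B] [CharZero B]
    [Algebra.IsIntegral ℤ B] (θ : B) (p : ℕ) [Fact p.Prime] (g M : ℤ[X]) (e : ℕ) (he : 2 ≤ e)
    (hθ : aeval θ (g ^ e + C (p : ℤ) * M) = 0)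
    (hcop : IsCoprime (g.map (Int.castRingHom (ZMod p))) (M.map (Int.castRingHom (ZMod p))))
    (x : B) (hx : (p : B) * x ∈ Algebra.adjoin ℤ {θ}) : x ∈ Algebra.adjoin ℤ {θ} := by
  let A := Algebra.adjoin ℤ {θ}
  have : IsNoetherianRing A := isNoetherianRing_of_fg ⟨{θ}, by simp [A]⟩
  have : Algebra.IsIntegral A B := Algebra.IsIntegral.tower_top (R := ℤ)
  have hA : ∀ z : B, z ∈ (algebraMap A B).range ↔ z ∈ A := by
    intro z
    simp [A]
  rw [← hA] at hx ⊢
  let θ' : A := ⟨θ, Algebra.self_mem_adjoin_singleton ℤ θ⟩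
  have hcoe (f : ℤ[X]) : ((aeval θ' f : A) : B) = aeval θ f :=
    (aeval_algebraMap_apply B θ' f).symm
  let π : ℤ[X] →+* A := (aeval θ').toRingHom
  have hπ : Function.Surjective π := by
    rintro ⟨z, hz⟩
    have hz' : z ∈ Algebra.adjoin ℤ {θ} := hz
    rw [Algebra.adjoin_singleton_eq_range_aeval] at hz'
    obtain ⟨f, rfl⟩ := hz'
    exact ⟨f, Subtype.ext (hcoe f)⟩
  have hπp : π (C (p : ℤ)) = p := by simp [π]
  have hπF : π g ^ e + p * π M = 0 := by
    rw [← hπp, ← map_pow, ← map_mul, ← map_add]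
    exact Subtype.ext ((hcoe _).trans hθ)
  refine mem_range_of_mul_mem_range (p : A) (by exact_mod_cast (Fact.out : p.Prime).ne_zero)
    (fun P hP hpP ↦ ?_) x (by simpa using hx)
  obtain ⟨φ, hφ, hgen⟩ := exists_generator_modulo_prime p (P.comap π)
  have hpC : C (p : ℤ) ∈ P.comap π := by rwa [Ideal.mem_comap, hπp]
  have hgP : g ∈ P.comap π := by
    apply hP.mem_of_pow_mem e
    rw [eq_neg_of_add_eq_zero_left hπF]
    exact P.neg_mem (P.mul_mem_right _ hpP)
  have hMP : M ∉ P.comap π := by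
    intro hMP
    obtain ⟨u', v', huv⟩ := hcop
    obtain ⟨u, rfl⟩ := map_surjective _ (ZMod.ringHom_surjective (Int.castRingHom (ZMod p))) u'
    obtain ⟨v, rfl⟩ := map_surjective _ (ZMod.ringHom_surjective (Int.castRingHom (ZMod p))) v'
    obtain ⟨w, hw⟩ := (C_dvd_iff_map_castRingHom_eq_zero p (u * g + v * M - 1)).2 (by
      simp [huv])
    have h1 : (1 : ℤ[X]) = u * g + v * M - C (p : ℤ) * w := by rw [← hw]; ring
    apply (P.comap π).ne_top_iff_one.1 (hP.comap π).ne_top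
    rw [h1]
    exact Ideal.sub_mem _ (Ideal.add_mem _ (Ideal.mul_mem_left _ _ hgP)
      (Ideal.mul_mem_left _ _ hMP)) (Ideal.mul_mem_right _ _ hpC)
  obtain ⟨q, w, hqw⟩ := hgen g hgP
  refine ⟨π φ, hφ, π (M + C (p : ℤ) ^ (e - 1) * w ^ e), ?_, ?_, ?_⟩
  · intro hu
    apply hMP
    refine (Ideal.add_mem_iff_left _ ?_).1 hu
    exact Ideal.mul_mem_right _ _ (Ideal.pow_mem_of_mem _ hpC _ (by lia))
  · obtain ⟨z, hz⟩ := sub_dvd_pow_sub_pow g (C (p : ℤ) * w) e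
    have hgw : g - C (p : ℤ) * w = φ * q := by rw [hqw]; ring
    rw [hgw, mul_pow] at hz
    have hz' := congrArg π hz
    obtain ⟨e, rfl⟩ : ∃ d, e = d + 1 := ⟨e - 1, by lia⟩
    simp only [map_sub, map_mul, map_pow, map_add, hπp, Nat.add_sub_cancel] at hz' ⊢
    exact ⟨- (π q * π z), by linear_combination hπF - hz'⟩
  · intro z hz
    obtain ⟨h, rfl⟩ := hπ z
    obtain ⟨q, w, rfl⟩ := hgen h hz
    rw [Ideal.mem_span_pair]
    exact ⟨π q, π w, by rw [map_add, map_mul, map_mul, hπp]; ring⟩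

theorem dvd_of_mul_mem_span_pair {B : Type*} [CommRing B] [IsDomain B] [IsIntegrallyClosed B]
    {p φ U : B} (hp : p ≠ 0) (hU : U ∈ Ideal.span {φ, p})
    (hφU : ∃ z ∈ Ideal.span {φ, p}, φ * U = p * z) : p ∣ U := by
  have hpL : algebraMap B (FractionRing B) p ≠ 0 :=
    (map_ne_zero_iff _ (IsFractionRing.injective B (FractionRing B))).2 hp
  obtain ⟨z, hz, hφz⟩ := hφU
  have hmem (v : B) (hv : v ∈ Ideal.span {φ, p}) :
      algebraMap B (FractionRing B) v ∈ Submodule.span B {algebraMap B (FractionRing B) φ, algebraMap B (FractionRing B) p} := by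
    obtain ⟨a, b, rfl⟩ := Ideal.mem_span_pair.1 hv
    exact Submodule.mem_span_pair.2 ⟨a, b, by simp [Algebra.smul_def]⟩
  have hint : IsIntegral B (algebraMap B (FractionRing B) U / algebraMap B (FractionRing B) p) := by
    refine isIntegral_of_smul_mem_submodule (M := FractionRing B)
      (Submodule.span B {algebraMap B (FractionRing B) φ, algebraMap B (FractionRing B) p}) ?_
      (Submodule.fg_span (by simp)) _ fun v hv ↦ ?_
    · exact (Submodule.ne_bot_iff _).2 ⟨_, Submodule.subset_span (by simp), hpL⟩
    · obtain ⟨a, b, rfl⟩ := Submodule.mem_span_pair.1 hv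
      have : (algebraMap B (FractionRing B) U / algebraMap B (FractionRing B) p) •
          (a • algebraMap B (FractionRing B) φ + b • algebraMap B (FractionRing B) p) =
          a • algebraMap B (FractionRing B) z + b • algebraMap B (FractionRing B) U := by
        have h := congrArg (algebraMap B (FractionRing B)) hφz
        rw [map_mul, map_mul] at h
        rw [smul_eq_mul]
        simp only [Algebra.smul_def]
        field_simp
        linear_combination algebraMap B (FractionRing B) a * h
      rw [this]
      exact add_mem (Submodule.smul_mem _ _ (hmem z hz)) (Submodule.smul_mem _ _ (hmem U hU))
  obtain ⟨y, hy⟩ := IsIntegrallyClosed.isIntegral_iff.1 hint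
  refine ⟨y, IsFractionRing.injective B (FractionRing B) ?_⟩
  rw [map_mul, hy, mul_div_cancel₀ _ hpL]

/-- The other half of Dedekind's criterion: if `g` and `M` have a common factor modulo `p`, then
`ℤ[θ]` is not `p`-saturated in an integrally closed domain containing it. -/
theorem exists_notMem_adjoin_of_not_isCoprime {B : Type*} [CommRing B] [IsDomain B] [CharZero B]
    [IsIntegrallyClosed B] (θ : B) (p : ℕ) [Fact p.Prime] (g M : ℤ[X]) (e : ℕ) (he : 2 ≤ e)
    (hg : g.map (Int.castRingHom (ZMod p)) ≠ 0)
    (hθ : aeval θ (g ^ e + C (p : ℤ) * M) = 0)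
    (hdvd : ∀ f : ℤ[X], aeval θ f = 0 → g ^ e + C (p : ℤ) * M ∣ f)
    (hcop : ¬ IsCoprime (g.map (Int.castRingHom (ZMod p))) (M.map (Int.castRingHom (ZMod p)))) :
    ∃ x ∉ Algebra.adjoin ℤ {θ}, (p : B) * x ∈ Algebra.adjoin ℤ {θ} := by
  classical
  have hp0 : (p : B) ≠ 0 := by
    exact_mod_cast (Fact.out : p.Prime).ne_zero
  let r := mapRingHom (Int.castRingHom (ZMod p))
  have hr : Function.Surjective r := map_surjective _ (ZMod.ringHom_surjective _)
  rw [← EuclideanDomain.gcd_isUnit_iff] at hcop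
  obtain ⟨φ, hφ⟩ := hr (EuclideanDomain.gcd (r g) (r M))
  change ¬ IsUnit (EuclideanDomain.gcd (r g) (r M)) at hcop
  have key (f : ℤ[X]) (hf : r φ ∣ r f) : ∃ h w, f = φ * h + C (p : ℤ) * w := by
    obtain ⟨h', hh⟩ := hf
    obtain ⟨h, rfl⟩ := hr h'
    obtain ⟨w, hw⟩ := (C_dvd_iff_map_castRingHom_eq_zero p (f - φ * h)).2 (by
      change r _ = 0
      rw [map_sub, map_mul, hh, sub_self])
    exact ⟨h, w, by rw [← hw]; ring⟩
  obtain ⟨h, w, hgφ⟩ := key g (hφ ▸ EuclideanDomain.gcd_dvd_left _ _)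
  obtain ⟨h₂, w₂, hMφ⟩ := key M (hφ ▸ EuclideanDomain.gcd_dvd_right _ _)
  rw [← hφ] at hcop
  have hrp : r (C (p : ℤ)) = 0 := by simp [r]
  obtain ⟨d, rfl⟩ : ∃ d, e = d + 2 := ⟨e - 2, by lia⟩
  let U : ℤ[X] := φ ^ (d + 1) * h ^ (d + 2)
  have hrU : r φ * r U = r g ^ (d + 2) := by
    simp only [U, hgφ, map_add, map_mul, map_pow, hrp]
    ring
  obtain ⟨y, w', hy⟩ : ∃ y w', g ^ (d + 2) =
      (φ * h) ^ (d + 2) + C (p : ℤ) * (φ * y + C (p : ℤ) * w') := by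
    obtain ⟨k, hk⟩ := powAddExpansion (φ * h) (C (p : ℤ) * w) (d + 2)
    refine ⟨(d + 2 : ℕ) * (φ ^ d * h ^ (d + 1)) * w, k * w ^ 2, ?_⟩
    rw [hgφ, hk, show d + 2 - 1 = d + 1 by lia]
    ring
  let ev : ℤ[X] →+* B := (aeval θ).toRingHom
  have hevp : ev (C (p : ℤ)) = p := by simp [ev]
  obtain ⟨β, hβ⟩ : (p : B) ∣ ev U := by
    refine dvd_of_mul_mem_span_pair hp0 (φ := ev φ) ?_ ?_
    · exact Ideal.mem_span_pair.2 ⟨ev (φ ^ d * h ^ (d + 2)), 0, by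
        simp only [U, map_mul, map_pow]; ring⟩
    · refine ⟨_, Ideal.mem_span_pair.2 ⟨-(ev h₂ + ev y), -(ev w₂ + ev w'), rfl⟩, ?_⟩
      have h0 : ev (g ^ (d + 2) + C (p : ℤ) * M) = 0 := hθ
      rw [hy, hMφ] at h0
      simp only [map_add, map_mul, map_pow, hevp, U] at h0 ⊢
      linear_combination h0
  clear_value U
  refine ⟨β, fun hβA ↦ hcop ?_, ?_⟩
  · rw [Algebra.adjoin_singleton_eq_range_aeval] at hβA
    obtain ⟨V, rfl⟩ := hβA
    obtain ⟨q, hq⟩ := hdvd (U - C (p : ℤ) * V) (by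
      have : ev (U - C (p : ℤ) * V) = 0 := by
        rw [ev.map_sub, ev.map_mul, hevp, hβ]
        exact sub_self _
      exact this)
    have hq' := congrArg r hq
    rw [r.map_sub, r.map_mul, r.map_mul, r.map_add, r.map_mul, hrp, r.map_pow, ← hrU] at hq'
    have hU0 : r U ≠ 0 := by
      intro h0
      rw [h0, mul_zero] at hrU
      exact hg (eq_zero_of_pow_eq_zero hrU.symm)
    refine IsUnit.of_mul_eq_one (r q) (mul_left_cancel₀ hU0 ?_)
    linear_combination -hq'
  · rw [← hβ, Algebra.adjoin_singleton_eq_range_aeval]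
    exact ⟨U, rfl⟩

theorem prime_dvd_index_of_nsmul_mem {G : Type*} [AddCommGroup G] (H : AddSubgroup G) {p : ℕ}
    (hp : p.Prime) {x : G} (hx : x ∉ H) (hpx : p • x ∈ H) : p ∣ H.index := by
  have := Fact.mk hp
  have : addOrderOf (x : G ⧸ H) = p := addOrderOf_eq_prime
    (by rwa [← QuotientAddGroup.mk_nsmul, QuotientAddGroup.eq_zero_iff])
    (by rwa [Ne, QuotientAddGroup.eq_zero_iff])
  exact this ▸ addOrderOf_dvd_natCard (x : G ⧸ H)

theorem exists_nsmul_mem_of_prime_dvd_index {G : Type*} [AddCommGroup G] (H : AddSubgroup G)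
    [Finite (G ⧸ H)] {p : ℕ} (hp : p.Prime) (h : p ∣ H.index) : ∃ x ∉ H, p • x ∈ H := by
  have := Fact.mk hp
  obtain ⟨y, hy⟩ := exists_prime_addOrderOf_dvd_card' (G := G ⧸ H) p h
  obtain ⟨x, rfl⟩ := QuotientAddGroup.mk_surjective y
  refine ⟨x, fun hx ↦ hp.one_lt.ne ?_, ?_⟩
  · rw [← hy, (QuotientAddGroup.eq_zero_iff x).2 hx, addOrderOf_zero]
  · rw [← QuotientAddGroup.eq_zero_iff, QuotientAddGroup.mk_nsmul, ← hy, addOrderOf_nsmul_eq_zero]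

theorem exists_smul_mem_adjoin {K : Type*} [Field K] [CharZero K] (θ x : K)
    (hx : x ∈ Algebra.adjoin ℚ {θ}) :
    ∃ m : ℤ, m ≠ 0 ∧ (m : K) * x ∈ Algebra.adjoin ℤ {θ} := by
  induction hx using Algebra.adjoin_induction with
  | mem x hx =>
    exact ⟨1, one_ne_zero, by simpa using Algebra.subset_adjoin hx⟩
  | algebraMap r =>
    refine ⟨r.den, by simp, ?_⟩
    have : ((r.den : ℤ) : K) * algebraMap ℚ K r = (r.num : K) := by
      rw [eq_ratCast]
      exact_mod_cast congrArg (Rat.cast : ℚ → K) (Rat.den_mul_eq_num r)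
    rw [this]
    exact intCast_mem _ _
  | add x y _ _ hx hy =>
    obtain ⟨m, hm, h1⟩ := hx
    obtain ⟨l, hl, h2⟩ := hy
    refine ⟨m * l, mul_ne_zero hm hl, ?_⟩
    have : ((m * l : ℤ) : K) * (x + y) = l * (m * x) + m * (l * y) := by push_cast; ring
    rw [this]
    exact add_mem (mul_mem (intCast_mem _ _) h1) (mul_mem (intCast_mem _ _) h2)
  | mul x y _ _ hx hy =>
    obtain ⟨m, hm, h1⟩ := hx
    obtain ⟨l, hl, h2⟩ := hy
    refine ⟨m * l, mul_ne_zero hm hl, ?_⟩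
    have : ((m * l : ℤ) : K) * (x * y) = (m * x) * (l * y) := by push_cast; ring
    rw [this]
    exact mul_mem h1 h2

theorem finite_quotient_adjoin {K : Type*} [Field K] [NumberField K]
    (θ : NumberField.RingOfIntegers K) (hgen : Algebra.adjoin ℚ {(θ : K)} = ⊤) :
    Finite (NumberField.RingOfIntegers K ⧸
      (Algebra.adjoin ℤ {θ}).toSubring.toAddSubgroup) := by
  have : AddGroup.FG (NumberField.RingOfIntegers K) :=
    Module.Finite.iff_addGroup_fg.1 inferInstance
  refine AddCommGroup.finite_of_fg_isAddTorsion _ fun y ↦ ?_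
  obtain ⟨x, rfl⟩ := QuotientAddGroup.mk_surjective y
  obtain ⟨m, hm, hmx⟩ := exists_smul_mem_adjoin (θ : K) x (hgen ▸ Algebra.mem_top)
  rw [isOfFinAddOrder_iff_zsmul_eq_zero]
  refine ⟨m, hm, ?_⟩
  rw [← QuotientAddGroup.mk_zsmul, QuotientAddGroup.eq_zero_iff]
  rw [Algebra.adjoin_singleton_eq_range_aeval] at hmx
  obtain ⟨f, hf⟩ := hmx
  have : aeval θ f = m • x := by
    apply NumberField.RingOfIntegers.coe_injective
    have h1 := aeval_algebraMap_apply K θ f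
    have h2 : aeval (θ : K) f = m * x := hf
    rw [zsmul_eq_mul, map_mul, map_intCast]
    exact h1.symm.trans h2
  change m • x ∈ Algebra.adjoin ℤ {θ}
  rw [← this]
  exact aeval_mem_adjoin_singleton ℤ θ

theorem exists_eq_pow_add_mul (n : ℕ) (hn : 3 ≤ n) (a c : ℤ) (p : ℕ) (hp : p.Prime)
    (j s : ℕ) (hns : n = p ^ j * s) (a₁ c₂ : ℤ) (ha₁ : a = (p : ℤ) * a₁)
    (hc₂ : (p : ℤ) * c₂ = c + (-c) ^ p ^ j) (Y : ℤ[X]) :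
    ∃ Q W, Y ^ n + C c * ∑ i ∈ Finset.Icc 1 n, (C a * Y) ^ (n - i) =
      (Y ^ s + C c) ^ p ^ j + C (p : ℤ) *
        (C c₂ + C (c * a₁) * Y + (Y ^ s + C c) * Q + C (p : ℤ) * W) := by
  obtain ⟨r, hr⟩ := exists_add_pow_prime_pow_eq hp (Y ^ s + C c) (-C c) j
  have hsum : ∑ i ∈ Finset.Icc 1 n, (C a * Y) ^ (n - i) = ∑ i ∈ Finset.range n, (C a * Y) ^ i :=
    Finset.sum_nbij' (n - ·) (n - ·) (by simp; lia) (by simp; lia) (by simp; lia) (by simp; lia)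
      (by simp)
  obtain ⟨m, rfl⟩ : ∃ m, n = m + 2 := ⟨n - 2, by lia⟩
  have hn' : Y ^ (m + 2) = (Y ^ s + C c + - C c) ^ p ^ j := by
    rw [add_neg_cancel_right, ← pow_mul, hns, mul_comm]
  have hc := congrArg (C : ℤ → ℤ[X]) hc₂
  rw [hsum, Finset.sum_range_succ', Finset.sum_range_succ', hn', hr]
  simp only [pow_add, ← Finset.sum_mul]
  refine ⟨-C c * r, C c * C a₁ ^ 2 * Y ^ 2 * ∑ i ∈ Finset.range m, (C a * Y) ^ i, ?_⟩
  simp only [map_add, map_mul, map_pow, map_neg, ha₁] at hc ⊢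
  simp only [map_natCast] at hc ⊢
  linear_combination -hc

theorem isCoprime_iff_ne_zero {k : Type*} [Field k] (s : ℕ) (hs : s ≠ 0) (c t d : k)
    (m : ℕ) (hm : m ≠ 0) (b : k) :
    IsCoprime ((X ^ m + C b) ^ s + C c) (C d + C t * (X ^ m + C b)) ↔
      (-d) ^ s + c * t ^ s ≠ 0 := by
  constructor
  · intro h h0
    obtain ⟨y, hy1, hy2⟩ : ∃ y : AlgebraicClosure k, y ^ s + algebraMap k _ c = 0 ∧
        algebraMap k _ d + algebraMap k _ t * y = 0 := by
      rcases eq_or_ne t 0 with rfl | ht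
      · obtain ⟨y, hy⟩ := IsAlgClosed.exists_pow_nat_eq (-algebraMap k (AlgebraicClosure k) c)
          (Nat.pos_of_ne_zero hs)
        have hd : d = 0 := by simpa [hs] using h0
        exact ⟨y, by rw [hy, neg_add_cancel], by simp [hd]⟩
      · refine ⟨algebraMap k _ (-d / t), ?_, ?_⟩
        · rw [← map_pow, ← map_add, div_pow, div_add' _ _ _ (pow_ne_zero s ht), h0, zero_div,
            map_zero]
        · rw [← map_mul, ← map_add, mul_div_cancel₀ _ ht, add_neg_cancel, map_zero]
    obtain ⟨x, hx⟩ := IsAlgClosed.exists_pow_nat_eq (y - algebraMap k _ b) (Nat.pos_of_ne_zero hm)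
    obtain ⟨u, v, huv⟩ := h
    have := congrArg (aeval x) huv
    simp [hx, hy1, hy2] at this
  · intro h
    obtain ⟨z, hz⟩ := sub_dvd_pow_sub_pow (C t * (X ^ m + C b)) (-C d) s
    refine ⟨C ((-d) ^ s + c * t ^ s)⁻¹ * C t ^ s, - C ((-d) ^ s + c * t ^ s)⁻¹ * z, ?_⟩
    have h1 : C ((-d) ^ s + c * t ^ s)⁻¹ * C ((-d) ^ s + c * t ^ s) = (1 : k[X]) := by
      rw [← C_mul, inv_mul_cancel₀ h, C_1]
    rw [← h1]
    simp only [C_add, C_mul, C_pow, C_neg, mul_pow] at hz ⊢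
    linear_combination C ((-d) ^ s + c * t ^ s)⁻¹ * hz

theorem stmt_6
    (n k : ℕ) (hn : 3 ≤ n) (hk : 1 ≤ k) (a b c : ℤ)
    (F : Polynomial ℤ)
    (hF : F = (X ^ k + C b) ^ n +
        C c * ∑ i ∈ Finset.Icc 1 n, (C a * (X ^ k + C b)) ^ (n - i))
    (hFdeg : F.natDegree = n * k)
    (hFirr : Irreducible (F.map (algebraMap ℤ ℚ)))
    (K : Type*) [Field K] [NumberField K]
    (θ : NumberField.RingOfIntegers K)
    (hθ : aeval θ F = 0)
    (hgen : Algebra.adjoin ℚ {(θ : K)} = ⊤)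
    (D : ℤ) (hD : IsDiscriminant F D)
    (p : ℕ) (hp : p.Prime) (hpD : (p : ℤ) ∣ D)
    (hpck : ¬ (p : ℤ) ∣ c * (k : ℤ)) (hpa : (p : ℤ) ∣ a) (hpn : p ∣ n)
    (j s : ℕ) (hns : n = p ^ j * s) (hps : ¬ p ∣ s)
    (a₁ c₂ : ℤ) (ha₁ : a = (p : ℤ) * a₁)
    (hc₂ : (p : ℤ) * c₂ = c + (-c) ^ p ^ j) :
    (¬ p ∣ (Algebra.adjoin ℤ {θ}).toSubring.toAddSubgroup.index) ↔
      ¬ (p : ℤ) ∣ ((-c₂) ^ s + c * (c * a₁) ^ s) := by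
  have := Fact.mk hp
  have hs0 : s ≠ 0 := by rintro rfl; exact hps (dvd_zero p)
  have hj0 : j ≠ 0 := by
    rintro rfl
    exact hps (by simpa [hns] using hpn)
  have he : 2 ≤ p ^ j := hp.two_le.trans (Nat.le_self_pow hj0 p)
  have hmonic : F.Monic := by
    have hY : (X ^ k + C b : ℤ[X]).Monic := monic_X_pow_add_C b (by lia)
    have hYdeg : (X ^ k + C b : ℤ[X]).natDegree = k := natDegree_X_pow_add_C
    rw [hF]
    refine (hY.pow n).add_of_left ?_
    rw [degree_eq_natDegree (hY.pow n).ne_zero, hY.natDegree_pow, hYdeg]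
    refine (degree_le_of_natDegree_le (n := (n - 1) * k) ?_).trans_lt ?_
    · refine (natDegree_C_mul_le _ _).trans (natDegree_sum_le_of_forall_le _ _ fun i hi ↦ ?_)
      refine (natDegree_pow_le_of_le (n - i) ((natDegree_C_mul_le a _).trans hYdeg.le)).trans ?_
      exact Nat.mul_le_mul_right k (by have := Finset.mem_Icc.1 hi; lia)
    · exact_mod_cast Nat.mul_lt_mul_of_pos_right (by lia : n - 1 < n) hk
  have hdvd : ∀ f : ℤ[X], aeval θ f = 0 → F ∣ f := by
    intro f hf
    have hint : IsIntegral ℤ θ := ⟨F, hmonic, hθ⟩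
    have hFirr' : Irreducible F :=
      (hmonic.irreducible_iff_irreducible_map_fraction_map (K := ℚ)).2 hFirr
    have h1 : minpoly ℤ θ ∣ F := minpoly.isIntegrallyClosed_dvd hint hθ
    have h2 : F ∣ minpoly ℤ θ :=
      (minpoly.irreducible hint).dvd_symm hFirr' h1
    exact h2.trans (minpoly.isIntegrallyClosed_dvd hint hf)
  obtain ⟨Q, W, hQW⟩ := exists_eq_pow_add_mul n hn a c p hp j s hns a₁ c₂ ha₁ hc₂ (X ^ k + C b)
  rw [← hF] at hQW
  have hcop : IsCoprime (((X ^ k + C b) ^ s + C c).map (Int.castRingHom (ZMod p)))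
      ((C c₂ + C (c * a₁) * (X ^ k + C b) + ((X ^ k + C b) ^ s + C c) * Q +
        C (p : ℤ) * W).map (Int.castRingHom (ZMod p))) ↔
      ¬ (p : ℤ) ∣ ((-c₂) ^ s + c * (c * a₁) ^ s) := by
    have h1 := isCoprime_iff_ne_zero s hs0 (c : ZMod p) (c * a₁ : ℤ) c₂ k (by lia) b
    rw [← ZMod.intCast_zmod_eq_zero_iff_dvd _ p]
    push_cast at h1 ⊢
    rw [← ne_eq, ← h1]
    simp [Polynomial.map_add, Polynomial.map_mul, IsCoprime.add_mul_left_right_iff]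
  rw [← hcop]
  constructor
  · intro h
    by_contra hnc
    apply h
    rw [hQW] at hθ hdvd hmonic
    obtain ⟨x, hx, hpx⟩ := exists_notMem_adjoin_of_not_isCoprime θ p _ _ _ he (by
      intro h0
      have := hmonic.map (Int.castRingHom (ZMod p))
      rw [Polynomial.map_add, Polynomial.map_pow, h0, Polynomial.map_mul, map_C] at this
      simp [zero_pow (by lia : p ^ j ≠ 0)] at this) hθ hdvd hnc
    refine prime_dvd_index_of_nsmul_mem _ hp (x := x) hx ?_
    rw [nsmul_eq_mul]
    exact hpx
  · intro h hdvdi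
    have := finite_quotient_adjoin θ hgen
    obtain ⟨x, hx, hpx⟩ := exists_nsmul_mem_of_prime_dvd_index _ hp hdvdi
    rw [nsmul_eq_mul] at hpx
    rw [hQW] at hθ
    exact hx (mem_adjoin_of_isCoprime θ p _ _ _ he hθ h x hpx)
end
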